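/- Let D be a connected C-homogeneous triangle-free digraph with more than one end. Then D is highly-arc-transitive. -/

import Mathlib

open Set

universe u

/-- The underlying undirected graph of a digraph given by its edge relation. -/
def UG {V : Type u} (E : V → V → Prop) : SimpleGraph V := SimpleGraph.fromRel E

/-- `E` is a digraph edge relation: irreflexive and antisymmetric. -/
def IsDigraph {V : Type u} (E : V → V → Prop) : Prop :=
  (∀ x, ¬ E x x) ∧ ∀ x y, E x y → ¬ E y x

/-- A ray in a graph: a one-way infinite path. -/
def IsRay {V : Type u} (G : SimpleGraph V) (r : ℕ → V) : Prop :=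
  Function.Injective r ∧ ∀ n, G.Adj (r n) (r (n + 1))

/-- A sequence is eventually in a set. -/
def EventuallyIn {V : Type u} (r : ℕ → V) (C : Set V) : Prop :=
  ∃ N, ∀ n, N ≤ n → r n ∈ C

/-- `C` is a connected component of the subgraph of `G` induced on `W`:
a maximal connected subset of `W`. -/
def IsCompOf {V : Type u} (G : SimpleGraph V) (C W : Set V) : Prop :=
  C.Nonempty ∧ C ⊆ W ∧ (G.induce C).Connected ∧
    ∀ C', C ⊆ C' → C' ⊆ W → (G.induce C').Connected → C' = C

/-- Two rays are equivalent if for every finite vertex set `S` they lie eventually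
in the same component of the graph minus `S`. -/
def RayEquiv {V : Type u} (G : SimpleGraph V) (r r' : ℕ → V) : Prop :=
  ∀ S : Finset V, ∃ C : Set V, IsCompOf G C {v | v ∉ S} ∧
    EventuallyIn r C ∧ EventuallyIn r' C

/-- The graph has more than one end: two inequivalent rays. -/
def MoreThanOneEnd {V : Type u} (G : SimpleGraph V) : Prop :=
  ∃ r r' : ℕ → V, IsRay G r ∧ IsRay G r' ∧ ¬ RayEquiv G r r'

/-- The graph has infinitely many ends: arbitrarily large families of pairwise
inequivalent rays. -/
def InfinitelyManyEnds {V : Type u} (G : SimpleGraph V) : Prop :=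
  ∀ n : ℕ, ∃ f : Fin n → (ℕ → V), (∀ i, IsRay G (f i)) ∧
    ∀ i j, i ≠ j → ¬ RayEquiv G (f i) (f j)

/-- A separation of a graph: a pair of vertex sets covering `V` such that every
edge lies within one side. -/
def IsSeparation {V : Type u} (G : SimpleGraph V) (c : Set V × Set V) : Prop :=
  c.1 ∪ c.2 = univ ∧ ∀ x y, G.Adj x y → (x ∈ c.1 ∧ y ∈ c.1) ∨ (x ∈ c.2 ∧ y ∈ c.2)

/-- The order of a separation: the number of vertices in its separator. -/
noncomputable def sepOrder {V : Type u} (c : Set V × Set V) : ℕ := (c.1 ∩ c.2).ncard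

/-- The neighbourhood of a vertex set. -/
def Nbhd {V : Type u} (G : SimpleGraph V) (A : Set V) : Set V :=
  {v | v ∉ A ∧ ∃ u ∈ A, G.Adj u v}

/-- The separation `(A, ∼)`. -/
def tildeSep {V : Type u} (G : SimpleGraph V) (A : Set V) : Set V × Set V :=
  (A, Aᶜ ∪ Nbhd G Aᶜ)

/-- `S` separates the wings of the separation `c`: every walk from one wing to
the other meets `S`. -/
def SeparatesWings {V : Type u} (G : SimpleGraph V) (c : Set V × Set V) (S : Set V) : Prop :=
  ∀ a ∈ c.1 \ c.2, ∀ b ∈ c.2 \ c.1, ∀ w : G.Walk a b, ∃ v ∈ w.support, v ∈ S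

/-- A separation of finite order with non-empty wings is essential if its first wing is
connected and no proper subset of the separator separates the wings. -/
def IsEssential {V : Type u} (G : SimpleGraph V) (c : Set V × Set V) : Prop :=
  IsSeparation G c ∧ (c.1 ∩ c.2).Finite ∧ (c.1 \ c.2).Nonempty ∧ (c.2 \ c.1).Nonempty ∧
  (G.induce (c.1 \ c.2)).Connected ∧
  ∀ S, S ⊂ c.1 ∩ c.2 → ¬ SeparatesWings G c S

/-- `C` is a wing of some separation in `𝒞`. -/
def IsWingOf {V : Type u} (𝒞 : Set (Set V × Set V)) (C : Set V) : Prop :=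
  ∃ d ∈ 𝒞, C = d.1 \ d.2 ∨ C = d.2 \ d.1

/-- A cut system. -/
def IsCutSystem {V : Type u} (G : SimpleGraph V) (𝒞 : Set (Set V × Set V)) : Prop :=
  𝒞.Nonempty ∧ (∀ c ∈ 𝒞, IsEssential G c) ∧
  (∀ c ∈ 𝒞, ∃ d ∈ 𝒞, d.1 ⊆ c.2) ∧
  (∀ c ∈ 𝒞, ∀ C : Set V, IsCompOf G C (c.2 \ c.1) →
    (∃ d ∈ 𝒞, d.1 \ d.2 ⊆ C) → tildeSep G (C ∪ Nbhd G C) ∈ 𝒞) ∧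
  (∀ c ∈ 𝒞, ∀ c' ∈ 𝒞, ∃ C₁ C₂ : Set V,
    ((IsCompOf G C₁ ((c.1 \ c.2) ∩ (c'.1 \ c'.2)) ∧
      IsCompOf G C₂ ((c.2 \ c.1) ∩ (c'.2 \ c'.1))) ∨
     (IsCompOf G C₁ ((c.2 \ c.1) ∩ (c'.1 \ c'.2)) ∧
      IsCompOf G C₂ ((c.1 \ c.2) ∩ (c'.2 \ c'.1)))) ∧
    IsWingOf 𝒞 C₁ ∧ IsWingOf 𝒞 C₂)

/-- Pick a side of a separation. -/
def pickSide {V : Type u} (c : Set V × Set V) : Bool → Set V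
  | false => c.1
  | true => c.2

/-- Two cuts are nested (with respect to the cut system `𝒞`). -/
def NestedPair {V : Type u} (G : SimpleGraph V) (𝒞 : Set (Set V × Set V))
    (c d : Set V × Set V) : Prop :=
  ∃ i j : Bool,
    ((¬ ∃ C, IsCompOf G C ((tildeSep G (pickSide c i ∩ pickSide d j)).1 \
        (tildeSep G (pickSide c i ∩ pickSide d j)).2) ∧
        tildeSep G (C ∪ Nbhd G C) ∈ 𝒞) ∨
     (¬ ∃ C, IsCompOf G C ((tildeSep G (pickSide c i ∩ pickSide d j)).2 \
        (tildeSep G (pickSide c i ∩ pickSide d j)).1) ∧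
        tildeSep G (C ∪ Nbhd G C) ∈ 𝒞)) ∧
    (c.1 ∩ c.2) ∪ (d.1 ∩ d.2) ⊆ pickSide c (!i) ∩ pickSide d (!j)

/-- A cut system is nested if each two of its cuts are nested. -/
def IsNestedSystem {V : Type u} (G : SimpleGraph V) (𝒞 : Set (Set V × Set V)) : Prop :=
  ∀ c ∈ 𝒞, ∀ d ∈ 𝒞, NestedPair G 𝒞 c d

/-- `S` is a `𝒞`-separator. -/
def IsSeparatorOf {V : Type u} (𝒞 : Set (Set V × Set V)) (S : Set V) : Prop :=
  ∃ c ∈ 𝒞, c.1 ∩ c.2 = S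

/-- A vertex set contains an end: some ray lies in it. -/
def ContainsEnd {V : Type u} (G : SimpleGraph V) (A : Set V) : Prop :=
  ∃ r : ℕ → V, IsRay G r ∧ ∀ n, r n ∈ A

/-- A basic cut system. -/
def IsBasic {V : Type u} (G : SimpleGraph V) (𝒞 : Set (Set V × Set V)) : Prop :=
  IsCutSystem G 𝒞 ∧
  (∀ c ∈ 𝒞, ∀ d ∈ 𝒞, ¬ sepOrder c < sepOrder d) ∧
  IsNestedSystem G 𝒞 ∧
  (∀ φ : G ≃g G, ∀ c ∈ 𝒞, ((⇑φ '' c.1, ⇑φ '' c.2) : Set V × Set V) ∈ 𝒞) ∧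
  (∀ S S' : Set V, IsSeparatorOf 𝒞 S → IsSeparatorOf 𝒞 S' → ∃ φ : G ≃g G, ⇑φ '' S = S') ∧
  (∀ c ∈ 𝒞, ContainsEnd G c.1 ∧ ContainsEnd G c.2 ∧
    ¬ ∃ d : Set V × Set V, IsSeparation G d ∧ (d.1 ∩ d.2).Finite ∧
      (d.1 ∩ d.2).ncard < sepOrder c ∧ ContainsEnd G d.1 ∧ ContainsEnd G d.2)

/-- The defining property of a `𝒞`-block. -/
def BlockProp {V : Type u} (𝒞 : Set (Set V × Set V)) (X : Set V) : Prop :=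
  (∀ c ∈ 𝒞, (X ⊆ c.1 ∨ X ⊆ c.2) ∧ ¬ (X ⊆ c.1 ∧ X ⊆ c.2)) ∧
  ∃ c ∈ 𝒞, X ⊆ c.1 ∧ c.1 ∩ c.2 ⊆ X

/-- A `𝒞`-block: a maximal vertex set with the block property. -/
def IsCBlock {V : Type u} (𝒞 : Set (Set V × Set V)) (X : Set V) : Prop :=
  BlockProp 𝒞 X ∧ ∀ X', X ⊆ X' → BlockProp 𝒞 X' → X' = X

/-- A digraph is C-homogeneous: every isomorphism between finite induced
subdigraphs with connected underlying graphs extends to an automorphism. -/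
def DigraphCHom {V : Type u} (E : V → V → Prop) : Prop :=
  ∀ (X Y : Set V), X.Finite → Y.Finite → ((UG E).induce X).Connected →
  ∀ φ : X ≃ Y, (∀ a b : X, E a.1 b.1 ↔ E (φ a).1 (φ b).1) →
  ∃ ψ : Equiv.Perm V, (∀ x y, E (ψ x) (ψ y) ↔ E x y) ∧ ∀ a : X, ψ a.1 = (φ a).1

/-- A graph is C-homogeneous: every isomorphism between finite connected induced
subgraphs extends to an automorphism. -/
def GraphCHom {V : Type u} (G : SimpleGraph V) : Prop :=
  ∀ (X Y : Set V), X.Finite → Y.Finite → (G.induce X).Connected →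
  ∀ φ : X ≃ Y, (∀ a b : X, G.Adj a.1 b.1 ↔ G.Adj (φ a).1 (φ b).1) →
  ∃ ψ : G ≃g G, ∀ a : X, ψ a.1 = (φ a).1

/-- The digraph contains a triangle: three pairwise adjacent vertices. -/
def HasTriangle {V : Type u} (E : V → V → Prop) : Prop :=
  ∃ x y z : V, (UG E).Adj x y ∧ (UG E).Adj y z ∧ (UG E).Adj x z

/-- An `n`-arc: a directed path `p 0, p 1, …, p n`. -/
def IsArc {V : Type u} (E : V → V → Prop) (n : ℕ) (p : ℕ → V) : Prop :=
  (∀ i j, i ≤ n → j ≤ n → p i = p j → i = j) ∧ ∀ i < n, E (p i) (p (i + 1))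

/-- A digraph is highly-arc-transitive: for every `n`, its automorphism group acts
transitively on `n`-arcs. -/
def HighlyArcTransitive {V : Type u} (E : V → V → Prop) : Prop :=
  ∀ n : ℕ, ∀ p q : ℕ → V, IsArc E n p → IsArc E n q →
  ∃ ψ : Equiv.Perm V, (∀ x y, E (ψ x) (ψ y) ↔ E x y) ∧ ∀ i ≤ n, ψ (p i) = q i

/-- An alternating walk `w 0, …, w n` in a digraph. -/
def IsAltWalk {V : Type u} (E : V → V → Prop) (n : ℕ) (w : ℕ → V) : Prop :=
  (∀ i < n, E (w i) (w (i + 1)) ∨ E (w (i + 1)) (w i)) ∧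
  ∀ i, i + 2 ≤ n → (E (w i) (w (i + 1)) ↔ E (w (i + 2)) (w (i + 1)))

/-- The edge `e` lies on the walk `w 0, …, w n` (in either direction). -/
def EdgeOnWalk {V : Type u} (n : ℕ) (w : ℕ → V) (e : V × V) : Prop :=
  ∃ i < n, (w i = e.1 ∧ w (i + 1) = e.2) ∨ (w i = e.2 ∧ w (i + 1) = e.1)

/-- Two edges are reachable from each other: they lie on a common alternating walk. -/
def Reach {V : Type u} (E : V → V → Prop) (e f : V × V) : Prop :=
  ∃ n w, IsAltWalk E n w ∧ EdgeOnWalk n w e ∧ EdgeOnWalk n w f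

/-- The edge relation of the reachability digraph `Δ_e`. -/
def DeltaRel {V : Type u} (E : V → V → Prop) (e : V × V) : V → V → Prop :=
  fun x y => E x y ∧ Reach E e (x, y)

/-- The underlying undirected graph of the reachability digraph `Δ_e`. -/
def DeltaGraph {V : Type u} (E : V → V → Prop) (e : V × V) : SimpleGraph V :=
  UG (DeltaRel E e)

/-- Tails of edges of `𝒜(e)`. -/
def Tails {V : Type u} (E : V → V → Prop) (e : V × V) : Set V :=
  {x | ∃ y, DeltaRel E e x y}

/-- Heads of edges of `𝒜(e)`. -/
def Heads {V : Type u} (E : V → V → Prop) (e : V × V) : Set V :=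
  {y | ∃ x, DeltaRel E e x y}

/-- The set of descendants of a vertex. -/
def Descendants {V : Type u} (E : V → V → Prop) (x : V) : Set V :=
  {y | ∃ n p, IsArc E n p ∧ p 0 = x ∧ p n = y}

/-- `(X, Y)` is a bipartition of the graph `G`. -/
def IsBipartition {V : Type u} (G : SimpleGraph V) (X Y : Set V) : Prop :=
  X ∪ Y = univ ∧ Disjoint X Y ∧
  ∀ a b, G.Adj a b → (a ∈ X ∧ b ∈ Y) ∨ (a ∈ Y ∧ b ∈ X)

/-- `G` with sides `X`, `Y` is C-homogeneous bipartite: every isomorphism between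
finite connected induced subgraphs preserving the sides extends to a side-preserving
automorphism. -/
def BipCHom {V : Type u} (G : SimpleGraph V) (X Y : Set V) : Prop :=
  ∀ (A B : Set V), A.Finite → B.Finite → (G.induce A).Connected →
  ∀ φ : A ≃ B, (∀ a b : A, G.Adj a.1 b.1 ↔ G.Adj (φ a).1 (φ b).1) →
  (∀ a : A, a.1 ∈ X ↔ (φ a).1 ∈ X) → (∀ a : A, a.1 ∈ Y ↔ (φ a).1 ∈ Y) →
  ∃ ψ : G ≃g G, (∀ v, v ∈ X ↔ ψ v ∈ X) ∧ (∀ v, v ∈ Y ↔ ψ v ∈ Y) ∧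
    ∀ a : A, ψ a.1 = (φ a).1

/-- `G` with sides `X`, `Y` is homogeneous bipartite: every isomorphism between
finite induced subgraphs preserving the sides extends to a side-preserving
automorphism. -/
def BipHom {V : Type u} (G : SimpleGraph V) (X Y : Set V) : Prop :=
  ∀ (A B : Set V), A.Finite → B.Finite →
  ∀ φ : A ≃ B, (∀ a b : A, G.Adj a.1 b.1 ↔ G.Adj (φ a).1 (φ b).1) →
  (∀ a : A, a.1 ∈ X ↔ (φ a).1 ∈ X) → (∀ a : A, a.1 ∈ Y ↔ (φ a).1 ∈ Y) →
  ∃ ψ : G ≃g G, (∀ v, v ∈ X ↔ ψ v ∈ X) ∧ (∀ v, v ∈ Y ↔ ψ v ∈ Y) ∧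
    ∀ a : A, ψ a.1 = (φ a).1

/-- `G` with sides `X`, `Y` is generic bipartite. -/
def GenericBip {V : Type u} (G : SimpleGraph V) (X Y : Set V) : Prop :=
  (∀ U W : Set V, U ⊆ X → W ⊆ X → U.Finite → W.Finite → Disjoint U W →
    ∃ v ∈ Y, (∀ u ∈ U, G.Adj v u) ∧ ∀ w ∈ W, ¬ G.Adj v w) ∧
  (∀ U W : Set V, U ⊆ Y → W ⊆ Y → U.Finite → W.Finite → Disjoint U W →
    ∃ v ∈ X, (∀ u ∈ U, G.Adj v u) ∧ ∀ w ∈ W, ¬ G.Adj v w)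

section Separators

open Classical

variable {V : Type u} {G : SimpleGraph V}

/-- `x` and `y` are joined by a walk avoiding `F`. -/
def Linked (G : SimpleGraph V) (F : Finset V) (x y : V) : Prop :=
  ∃ p : G.Walk x y, ∀ v ∈ p.support, v ∉ F

theorem Linked.left {F : Finset V} {x y : V} (h : Linked G F x y) : x ∉ F := by
  obtain ⟨p, hp⟩ := h
  exact hp x p.start_mem_support

theorem Linked.right {F : Finset V} {x y : V} (h : Linked G F x y) : y ∉ F := by
  obtain ⟨p, hp⟩ := h
  exact hp y p.end_mem_support

theorem Linked.refl {F : Finset V} {x : V} (h : x ∉ F) : Linked G F x x :=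
  ⟨.nil, by simpa using h⟩

theorem Linked.symm {F : Finset V} {x y : V} (h : Linked G F x y) : Linked G F y x := by
  obtain ⟨p, hp⟩ := h
  exact ⟨p.reverse, by simpa using hp⟩

theorem Linked.trans {F : Finset V} {x y z : V} (h : Linked G F x y) (h' : Linked G F y z) :
    Linked G F x z := by
  obtain ⟨p, hp⟩ := h
  obtain ⟨q, hq⟩ := h'
  refine ⟨p.append q, fun v hv => ?_⟩
  rcases (SimpleGraph.Walk.mem_support_append_iff p q).1 hv with hv | hv
  exacts [hp v hv, hq v hv]

theorem Linked.of_adj {F : Finset V} {x y : V} (h : G.Adj x y) (hx : x ∉ F) (hy : y ∉ F) :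
    Linked G F x y :=
  ⟨h.toWalk, by simp [hx, hy]⟩

theorem Linked.step {F : Finset V} {x y z : V} (h : Linked G F x y) (hyz : G.Adj y z)
    (hz : z ∉ F) : Linked G F x z :=
  h.trans (.of_adj hyz h.right hz)

/-- A walk avoiding `F` does not leave a set whose neighbours all lie in `F`. -/
theorem Linked.mem_of_closed {F : Finset V} {K : Set V} {x y : V} (h : Linked G F x y)
    (hx : x ∈ K) (hK : ∀ a ∈ K, ∀ b, G.Adj a b → b ∉ F → b ∈ K) : y ∈ K := by
  obtain ⟨p, hp⟩ := h
  induction p with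
  | nil => exact hx
  | cons hadj p ih =>
    refine ih (hK _ hx _ hadj (hp _ ?_)) fun v hv => hp v ?_
    · simp
    · simp [hv]

/-- A component of `G - F` that avoids `F'` is connected in `G - F'`. -/
theorem Linked.of_forall_notMem {F F' : Finset V} {x y : V} (h : Linked G F x y)
    (hF' : ∀ z, Linked G F x z → z ∉ F') : Linked G F' x y := by
  have := h.mem_of_closed (K := {z | Linked G F x z ∧ Linked G F' x z})
    ⟨.refl h.left, .refl (hF' x (.refl h.left))⟩
    (fun a ha b hab hb => ⟨ha.1.step hab hb, ha.2.step hab (hF' b (ha.1.step hab hb))⟩)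
  exact this.2

/-- The component of `G - F` in which the ray `ρ` eventually lies. -/
def rayComp (G : SimpleGraph V) (F : Finset V) (ρ : ℕ → V) : Set V :=
  {y | ∃ N, ∀ n, N ≤ n → Linked G F (ρ n) y}

theorem IsRay.eventually_linked {ρ : ℕ → V} (hρ : IsRay G ρ) (F : Finset V) :
    ∃ N, ∀ m n, N ≤ m → N ≤ n → Linked G F (ρ m) (ρ n) := by
  have hfin : (ρ ⁻¹' (F : Set V)).Finite := F.finite_toSet.preimage hρ.1.injOn
  obtain ⟨N, hN⟩ := hfin.bddAbove
  have hout : ∀ n, N + 1 ≤ n → ρ n ∉ F := fun n hn hF => by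
    have := hN (show n ∈ ρ ⁻¹' (F : Set V) from hF)
    omega
  have key : ∀ n, N + 1 ≤ n → Linked G F (ρ (N + 1)) (ρ n) := by
    intro n hn
    induction n, hn using Nat.le_induction with
    | base => exact .refl (hout _ le_rfl)
    | succ n hn ih => exact ih.step (hρ.2 n) (hout _ (by omega))
  exact ⟨N + 1, fun m n hm hn => (key m hm).symm.trans (key n hn)⟩

theorem IsRay.eventually_mem_rayComp {ρ : ℕ → V} (hρ : IsRay G ρ) (F : Finset V) :
    ∃ N, ∀ n, N ≤ n → ρ n ∈ rayComp G F ρ := by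
  obtain ⟨N, hN⟩ := hρ.eventually_linked F
  exact ⟨N, fun n hn => ⟨N, fun m hm => hN m n hm hn⟩⟩

theorem linked_of_mem_rayComp {F : Finset V} {ρ : ℕ → V} {x y : V} (hx : x ∈ rayComp G F ρ)
    (hy : y ∈ rayComp G F ρ) : Linked G F x y := by
  obtain ⟨N, hN⟩ := hx
  obtain ⟨M, hM⟩ := hy
  exact (hN (max N M) (le_max_left _ _)).symm.trans (hM (max N M) (le_max_right _ _))

theorem Linked.mem_rayComp {F : Finset V} {ρ : ℕ → V} {x y : V} (h : Linked G F x y)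
    (hx : x ∈ rayComp G F ρ) : y ∈ rayComp G F ρ := by
  obtain ⟨N, hN⟩ := hx
  exact ⟨N, fun n hn => (hN n hn).trans h⟩

theorem notMem_of_mem_rayComp {F : Finset V} {ρ : ℕ → V} {x : V} (hx : x ∈ rayComp G F ρ) :
    x ∉ F :=
  (linked_of_mem_rayComp hx hx).left

theorem rayComp_mono {F F' : Finset V} (h : F ⊆ F') (ρ : ℕ → V) :
    rayComp G F' ρ ⊆ rayComp G F ρ := by
  rintro y ⟨N, hN⟩
  refine ⟨N, fun n hn => ?_⟩
  obtain ⟨p, hp⟩ := hN n hn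
  exact ⟨p, fun v hv hF => hp v hv (h hF)⟩

theorem not_linked_of_disjoint {F : Finset V} {ρ ρ' : ℕ → V} {x y : V}
    (h : Disjoint (rayComp G F ρ) (rayComp G F ρ')) (hx : x ∈ rayComp G F ρ)
    (hy : y ∈ rayComp G F ρ') : ¬ Linked G F x y := fun hl =>
  Set.disjoint_left.1 h (hl.mem_rayComp hx) hy

/-- Two rays that end up in a set closed in `G - F`, respectively outside of it, lie in
different components of `G - F`. -/
theorem disjoint_rayComp_of_closed {F : Finset V} {K : Set V} {ρ ρ' : ℕ → V}
    (hK : ∀ a ∈ K, ∀ b, G.Adj a b → b ∉ F → b ∈ K) (hρ : ∃ N, ∀ n, N ≤ n → ρ n ∈ K)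
    (hρ' : ∃ N, ∀ n, N ≤ n → ρ' n ∉ K) : Disjoint (rayComp G F ρ) (rayComp G F ρ') := by
  rw [Set.disjoint_left]
  rintro x ⟨N, hN⟩ ⟨M, hM⟩
  obtain ⟨N', hN'⟩ := hρ
  obtain ⟨M', hM'⟩ := hρ'
  have h1 := hN (max N N') (le_max_left _ _)
  have h2 := hM (max M M') (le_max_left _ _)
  exact hM' _ (le_max_right _ _)
    ((h1.trans h2.symm).mem_of_closed (hN' _ (le_max_right _ _)) hK)

/-- `F` separates two ends. -/
def SeparatesEnds (G : SimpleGraph V) (F : Finset V) : Prop :=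
  ∃ ρ ρ' : ℕ → V, IsRay G ρ ∧ IsRay G ρ' ∧ Disjoint (rayComp G F ρ) (rayComp G F ρ')

/-- `F` separates two ends and has minimum order among all such sets. -/
def IsMinSep (G : SimpleGraph V) (F : Finset V) : Prop :=
  SeparatesEnds G F ∧ ∀ F', SeparatesEnds G F' → F.card ≤ F'.card

/-- `U` is not separated by `F`. -/
def NotSplit (G : SimpleGraph V) (F U : Finset V) : Prop :=
  ∀ u ∈ U, ∀ v ∈ U, u ∉ F → v ∉ F → Linked G F u v

theorem IsMinSep.exists_disjoint {S : Finset V} (hS : IsMinSep G S) (ρ : ℕ → V) :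
    ∃ ρ', IsRay G ρ' ∧ Disjoint (rayComp G S ρ) (rayComp G S ρ') := by
  obtain ⟨⟨ρ₁, ρ₂, h₁, h₂, hd⟩, -⟩ := hS
  by_cases h : Disjoint (rayComp G S ρ) (rayComp G S ρ₁)
  · exact ⟨ρ₁, h₁, h⟩
  · refine ⟨ρ₂, h₂, Set.disjoint_left.2 fun x hx hx₂ => ?_⟩
    obtain ⟨y, hy, hy₁⟩ := Set.not_disjoint_iff.1 h
    exact not_linked_of_disjoint hd hy₁ hx₂ (linked_of_mem_rayComp hy hx)

/-- Every vertex of a minimum separator has a neighbour in each component containing a ray. -/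
theorem IsMinSep.exists_adj {S : Finset V} (hS : IsMinSep G S) {ρ : ℕ → V} (hρ : IsRay G ρ)
    {s : V} (hs : s ∈ S) : ∃ k ∈ rayComp G S ρ, G.Adj s k := by
  by_contra! hcon
  obtain ⟨ρ', hρ', hd⟩ := hS.exists_disjoint ρ
  have hsep : SeparatesEnds G (S.erase s) := by
    refine ⟨ρ, ρ', hρ, hρ', disjoint_rayComp_of_closed (K := rayComp G S ρ) ?_
      (hρ.eventually_mem_rayComp S) ?_⟩
    · intro a ha b hab hb
      have hbs : b ≠ s := by
        rintro rfl
        exact hcon a ha hab.symm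
      have hbS : b ∉ S := fun h => hb (Finset.mem_erase.2 ⟨hbs, h⟩)
      exact (Linked.of_adj hab (notMem_of_mem_rayComp ha) hbS).mem_rayComp ha
    · obtain ⟨N, hN⟩ := hρ'.eventually_mem_rayComp S
      exact ⟨N, fun n hn h => Set.disjoint_left.1 hd h (hN n hn)⟩
  have := hS.2 _ hsep
  have := Finset.card_erase_lt_of_mem hs
  omega

/-- A component containing a ray that avoids `U`, together with the rest of its boundary,
lies in one component of `G - U`. -/
theorem IsMinSep.linked_of_disjoint {S U : Finset V} (hS : IsMinSep G S) {ρ : ℕ → V}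
    (hρ : IsRay G ρ) (hU : ∀ u ∈ U, u ∉ rayComp G S ρ) {x y : V}
    (hx : x ∈ rayComp G S ρ ∨ x ∈ S ∧ x ∉ U) (hy : y ∈ rayComp G S ρ ∨ y ∈ S ∧ y ∉ U) :
    Linked G U x y := by
  have hin : ∀ a ∈ rayComp G S ρ, ∀ b ∈ rayComp G S ρ, Linked G U a b := fun a ha b hb =>
    (linked_of_mem_rayComp ha hb).of_forall_notMem fun z hz hzU => hU z hzU (hz.mem_rayComp ha)
  have hex : ∀ a, a ∈ rayComp G S ρ ∨ a ∈ S ∧ a ∉ U →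
      ∃ k ∈ rayComp G S ρ, Linked G U a k := by
    rintro a (ha | ⟨ha, haU⟩)
    · exact ⟨a, ha, hin a ha a ha⟩
    · obtain ⟨k, hk, hak⟩ := hS.exists_adj hρ ha
      exact ⟨k, hk, .of_adj hak haU fun h => hU k h hk⟩
  obtain ⟨k, hk, hxk⟩ := hex x hx
  obtain ⟨l, hl, hyl⟩ := hex y hy
  exact hxk.trans ((hin k hk l hl).trans hyl.symm)

theorem IsMinSep.notSplit_of_disjoint {S U : Finset V} (hS : IsMinSep G S) {ρ : ℕ → V}
    (hρ : IsRay G ρ) (hU : ∀ u ∈ U, u ∉ rayComp G S ρ) : NotSplit G U S :=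
  fun _ hx _ hy hxU hyU => hS.linked_of_disjoint hρ hU (.inr ⟨hx, hxU⟩) (.inr ⟨hy, hyU⟩)

/-- A set not separated by `S` misses one of two given components of `G - S`. -/
theorem NotSplit.disjoint_or {S U : Finset V} (h : NotSplit G S U) {ρ ρ' : ℕ → V}
    (hd : Disjoint (rayComp G S ρ) (rayComp G S ρ')) :
    (∀ u ∈ U, u ∉ rayComp G S ρ) ∨ ∀ u ∈ U, u ∉ rayComp G S ρ' := by
  by_contra! hcon
  obtain ⟨⟨u, hu, hu1⟩, v, hv, hv1⟩ := hcon
  exact not_linked_of_disjoint hd hu1 hv1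
    (h u hu v hv (notMem_of_mem_rayComp hu1) (notMem_of_mem_rayComp hv1))

theorem IsMinSep.notSplit_symm {S U : Finset V} (hS : IsMinSep G S) (h : NotSplit G S U) :
    NotSplit G U S := by
  obtain ⟨⟨ρ₁, ρ₂, h₁, h₂, hd⟩, -⟩ := id hS
  rcases h.disjoint_or hd with h | h
  exacts [hS.notSplit_of_disjoint h₁ h, hS.notSplit_of_disjoint h₂ h]

/-- If `U` separates `S`, then `S` meets every component of `G - U` containing a ray. -/
theorem IsMinSep.exists_mem_of_split {S U : Finset V} (hS : IsMinSep G S) (hU : IsMinSep G U)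
    (h : ¬ NotSplit G U S) {ρ : ℕ → V} (hρ : IsRay G ρ) : ∃ s ∈ S, s ∈ rayComp G U ρ := by
  by_contra! hcon
  exact h (hS.notSplit_symm (hU.notSplit_of_disjoint hρ hcon))

/-- The separators splitting `S`. -/
def splitters (G : SimpleGraph V) (S : Finset V) : Set (Finset V) :=
  {U | IsMinSep G U ∧ ¬ NotSplit G U S}

/-- There are only finitely many minimal separators of given order between two vertices. -/
theorem finite_tight_separators (a b : V) (n : ℕ) (F : Finset V) :
    {U : Finset V | F ⊆ U ∧ U.card = F.card + n ∧ ¬ Linked G U a b ∧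
      ∀ u ∈ U, ∃ x y, G.Adj u x ∧ G.Adj u y ∧ Linked G U a x ∧ Linked G U b y}.Finite := by
  induction n generalizing F with
  | zero =>
    refine (Set.finite_singleton F).subset ?_
    rintro U ⟨hF, hc, -⟩
    exact (Finset.eq_of_subset_of_card_le hF (by omega)).symm
  | succ n ih =>
    by_cases hl : Linked G F a b
    · obtain ⟨p, hp⟩ := hl
      have hfin : (⋃ v ∈ {v | v ∈ p.support}, {U : Finset V | insert v F ⊆ U ∧
          U.card = (insert v F).card + n ∧ ¬ Linked G U a b ∧
          ∀ u ∈ U, ∃ x y, G.Adj u x ∧ G.Adj u y ∧ Linked G U a x ∧ Linked G U b y}).Finite :=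
        (List.finite_toSet p.support).biUnion fun v _ => ih _
      refine hfin.subset ?_
      rintro U ⟨hF, hc, hab, ht⟩
      have : ∃ v ∈ p.support, v ∈ U := by
        by_contra! hcon
        exact hab ⟨p, hcon⟩
      obtain ⟨v, hv, hvU⟩ := this
      simp only [Set.mem_iUnion]
      refine ⟨v, hv, Finset.insert_subset hvU hF, ?_, hab, ht⟩
      rw [Finset.card_insert_of_notMem (hp v hv)]
      omega
    · convert Set.finite_empty
      rw [Set.eq_empty_iff_forall_notMem]
      rintro U ⟨hF, hc, hab, ht⟩
      obtain ⟨u, hu, huF⟩ : ∃ u ∈ U, u ∉ F := by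
        by_contra! hcon
        have := Finset.card_le_card hcon
        omega
      obtain ⟨x, y, hux, huy, hax, hby⟩ := ht u hu
      have hmono : ∀ {c d}, Linked G U c d → Linked G F c d := by
        rintro c d ⟨p, hp⟩
        exact ⟨p, fun v hv h => hp v hv (hF h)⟩
      exact hl (((hmono hax).step hux.symm huF).trans ((hmono hby).step huy.symm huF).symm)

theorem IsMinSep.finite_splitters {S : Finset V} (hS : IsMinSep G S) :
    (splitters G S).Finite := by
  have hfin : (⋃ a ∈ S, ⋃ b ∈ S, {U : Finset V | ∅ ⊆ U ∧ U.card = (∅ : Finset V).card + S.card ∧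
      ¬ Linked G U a b ∧
      ∀ u ∈ U, ∃ x y, G.Adj u x ∧ G.Adj u y ∧ Linked G U a x ∧ Linked G U b y}).Finite :=
    S.finite_toSet.biUnion fun a _ => S.finite_toSet.biUnion fun b _ =>
      finite_tight_separators a b _ _
  refine hfin.subset ?_
  rintro U ⟨hU, hUS⟩
  obtain ⟨⟨ρ₁, ρ₂, h₁, h₂, hd⟩, -⟩ := id hU
  obtain ⟨a, haS, ha⟩ := hS.exists_mem_of_split hU hUS h₁
  obtain ⟨b, hbS, hb⟩ := hS.exists_mem_of_split hU hUS h₂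
  simp only [Set.mem_iUnion]
  refine ⟨a, haS, b, hbS, Finset.empty_subset _, ?_, not_linked_of_disjoint hd ha hb, ?_⟩
  · have := hS.2 _ hU.1
    have := hU.2 _ hS.1
    simp
    omega
  · intro u hu
    obtain ⟨x, hx, hux⟩ := hU.exists_adj h₁ hu
    obtain ⟨y, hy, huy⟩ := hU.exists_adj h₂ hu
    exact ⟨x, y, hux, huy, linked_of_mem_rayComp ha hx, linked_of_mem_rayComp hb hy⟩

/-- Two minimum separators separate a common pair of ends. -/
theorem exists_common_rays {S S' : Finset V} (hS : IsMinSep G S) (hS' : IsMinSep G S') :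
    ∃ ρ ρ' : ℕ → V, IsRay G ρ ∧ IsRay G ρ' ∧ Disjoint (rayComp G S ρ) (rayComp G S ρ') ∧
      Disjoint (rayComp G S' ρ) (rayComp G S' ρ') := by
  obtain ⟨⟨r₁, r₂, hr₁, hr₂, hd⟩, -⟩ := id hS
  obtain ⟨⟨t₁, t₂, ht₁, ht₂, hd'⟩, -⟩ := id hS'
  have htr : ∀ {F : Finset V} {a b c : ℕ → V}, ¬ Disjoint (rayComp G F a) (rayComp G F b) →
      ¬ Disjoint (rayComp G F b) (rayComp G F c) →
      ¬ Disjoint (rayComp G F a) (rayComp G F c) := by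
    intro F a b c hab hbc
    obtain ⟨x, hxa, hxb⟩ := Set.not_disjoint_iff.1 hab
    obtain ⟨y, hyb, hyc⟩ := Set.not_disjoint_iff.1 hbc
    exact Set.not_disjoint_iff.2
      ⟨y, (linked_of_mem_rayComp hxb hyb).mem_rayComp hxa, hyc⟩
  have hsy : ∀ {F : Finset V} {a b : ℕ → V}, ¬ Disjoint (rayComp G F a) (rayComp G F b) →
      ¬ Disjoint (rayComp G F b) (rayComp G F a) := fun h h' => h h'.symm
  by_contra! hcon
  have e₁ := hcon r₁ r₂ hr₁ hr₂ hd
  have e₂ : ¬ Disjoint (rayComp G S t₁) (rayComp G S t₂) := fun h => hcon t₁ t₂ ht₁ ht₂ h hd'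
  by_cases h₁ : Disjoint (rayComp G S r₁) (rayComp G S t₁)
  · have a₁ := hcon r₁ t₁ hr₁ ht₁ h₁
    have h₂ : Disjoint (rayComp G S r₁) (rayComp G S t₂) := by
      by_contra h
      exact htr h (hsy e₂) h₁
    exact htr (hsy a₁) (hcon r₁ t₂ hr₁ ht₂ h₂) hd'
  · have h₂ : Disjoint (rayComp G S r₂) (rayComp G S t₁) := by
      by_contra h
      exact htr h₁ (hsy h) hd
    have h₃ : Disjoint (rayComp G S r₂) (rayComp G S t₂) := by
      by_contra h
      exact htr (htr h₁ e₂) (hsy h) hd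
    exact htr (hsy (hcon r₂ t₁ hr₂ ht₁ h₂)) (hcon r₂ t₂ hr₂ ht₂ h₃) hd'

/-- The boundary of the component of `G - (S ∪ S')` containing a tail of `ρ`. -/
noncomputable def cornerSep (G : SimpleGraph V) (S S' : Finset V) (ρ : ℕ → V) : Finset V :=
  (S ∪ S').filter fun t => ∃ c ∈ rayComp G (S ∪ S') ρ, G.Adj t c

theorem cornerSep_comm (S S' : Finset V) (ρ : ℕ → V) :
    cornerSep G S S' ρ = cornerSep G S' S ρ := by
  unfold cornerSep
  rw [Finset.union_comm]

theorem mem_of_mem_cornerSep {S S' : Finset V} {ρ : ℕ → V} {t : V}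
    (ht : t ∈ cornerSep G S S' ρ) : t ∈ S ∨ t ∈ rayComp G S ρ := by
  obtain ⟨-, c, hc, htc⟩ := Finset.mem_filter.1 ht
  by_cases h : t ∈ S
  · exact .inl h
  · have hc' := rayComp_mono Finset.subset_union_left ρ hc
    exact .inr ((Linked.of_adj htc.symm (notMem_of_mem_rayComp hc') h).mem_rayComp hc')

theorem separatesEnds_cornerSep {S S' : Finset V} {ρ ρ' : ℕ → V} (hρ : IsRay G ρ)
    (hρ' : IsRay G ρ') (hd : Disjoint (rayComp G S ρ) (rayComp G S ρ')) :
    SeparatesEnds G (cornerSep G S S' ρ) := by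
  refine ⟨ρ, ρ', hρ, hρ', disjoint_rayComp_of_closed (K := rayComp G (S ∪ S') ρ) ?_
    (hρ.eventually_mem_rayComp _) ?_⟩
  · intro a ha b hab hb
    have : b ∉ S ∪ S' := fun h => hb (Finset.mem_filter.2 ⟨h, a, ha, hab.symm⟩)
    exact (Linked.of_adj hab (notMem_of_mem_rayComp ha) this).mem_rayComp ha
  · obtain ⟨N, hN⟩ := hρ'.eventually_mem_rayComp S
    exact ⟨N, fun n hn h => Set.disjoint_left.1 hd
      (rayComp_mono Finset.subset_union_left ρ h) (hN n hn)⟩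

theorem card_cornerSep_add_le {S S' : Finset V} {ρ ρ' : ℕ → V}
    (hd : Disjoint (rayComp G S ρ) (rayComp G S ρ'))
    (hd' : Disjoint (rayComp G S' ρ) (rayComp G S' ρ')) :
    (cornerSep G S S' ρ).card + (cornerSep G S S' ρ').card ≤ S.card + S'.card := by
  rw [← Finset.card_union_add_card_inter, ← Finset.card_union_add_card_inter S S']
  refine add_le_add (Finset.card_le_card ?_) (Finset.card_le_card ?_)
  · exact Finset.union_subset (Finset.filter_subset _ _) (Finset.filter_subset _ _)
  · intro t ht
    obtain ⟨h₁, h₂⟩ := Finset.mem_inter.1 ht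
    have aux : ∀ {F F' : Finset V}, Disjoint (rayComp G F ρ) (rayComp G F ρ') →
        t ∈ cornerSep G F F' ρ → t ∈ cornerSep G F F' ρ' → t ∈ F := fun hF a b => by
      rcases mem_of_mem_cornerSep a with h | h
      · exact h
      · exact (mem_of_mem_cornerSep b).resolve_right (Set.disjoint_left.1 hF h)
    exact Finset.mem_inter.2 ⟨aux hd h₁ h₂,
      aux hd' (cornerSep_comm S S' ρ ▸ h₁) (cornerSep_comm S S' ρ' ▸ h₂)⟩

theorem isMinSep_cornerSep {S S' : Finset V} (hS : IsMinSep G S) (hS' : IsMinSep G S')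
    {ρ ρ' : ℕ → V} (hρ : IsRay G ρ) (hρ' : IsRay G ρ')
    (hd : Disjoint (rayComp G S ρ) (rayComp G S ρ'))
    (hd' : Disjoint (rayComp G S' ρ) (rayComp G S' ρ')) :
    IsMinSep G (cornerSep G S S' ρ) := by
  have h₁ := separatesEnds_cornerSep (S' := S') hρ hρ' hd
  have h₂ := separatesEnds_cornerSep (S' := S') hρ' hρ hd.symm
  refine ⟨h₁, fun F hF => ?_⟩
  have := card_cornerSep_add_le hd hd'
  have := hS.2 _ hF
  have := hS'.2 _ h₂
  omega

/-- A minimum separator splitting a corner of `S` and `S'` splits `S` or `S'`. -/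
theorem notSplit_cornerSep {S S' U : Finset V} (hS : IsMinSep G S) (hS' : IsMinSep G S')
    (hU : IsMinSep G U) (hSS' : ¬ NotSplit G S S') {ρ ρ' : ℕ → V} (hρ : IsRay G ρ)
    (hρ' : IsRay G ρ') (hd : Disjoint (rayComp G S ρ) (rayComp G S ρ'))
    (hd' : Disjoint (rayComp G S' ρ) (rayComp G S' ρ'))
    (h : NotSplit G U S) (h' : NotSplit G U S') : NotSplit G U (cornerSep G S S' ρ) := by
  have key : ∀ t ∈ cornerSep G S S' ρ, ∀ t' ∈ cornerSep G S S' ρ, t ∉ U → t' ∉ U →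
      t ∈ S → t' ∈ S' → Linked G U t t' := by
    intro t ht t' ht' htU htU' htS htS'
    by_contra hcon
    have htK' : t ∈ rayComp G S' ρ :=
      (mem_of_mem_cornerSep (cornerSep_comm S S' ρ ▸ ht)).resolve_left fun hx =>
        hcon (h' t hx t' htS' htU htU')
    have htK : t' ∈ rayComp G S ρ :=
      (mem_of_mem_cornerSep ht').resolve_left fun hx => hcon (h t htS t' hx htU htU')
    obtain ⟨z', hz', hzK⟩ := hS'.exists_mem_of_split hS hSS' hρ'
    obtain ⟨z, hz, hzK'⟩ := hS.exists_mem_of_split hS' (fun hx => hSS' (hS'.notSplit_symm hx)) hρ'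
    have hzU : z ∈ U := by
      by_contra hzU
      have hl := h t htS z hz htU hzU
      refine not_linked_of_disjoint hd' htK' hzK' (hl.of_forall_notMem fun w hw hwS' => ?_)
      exact hcon (hw.trans (h' w hwS' t' htS' hw.right htU'))
    have hzU' : z' ∈ U := by
      by_contra hzU
      have hl := h' t' htS' z' hz' htU' hzU
      refine not_linked_of_disjoint hd htK hzK (hl.of_forall_notMem fun w hw hwS => ?_)
      exact hcon ((h t htS w hwS htU hw.right).trans hw.symm)
    obtain ⟨N, hN⟩ := hρ.eventually_mem_rayComp U
    have meets : ∀ {F : Finset V} {y : V}, y ∈ U → y ∈ rayComp G F ρ' →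
        Disjoint (rayComp G F ρ) (rayComp G F ρ') → ∃ a ∈ F, a ∈ rayComp G U ρ := by
      intro F y hyU hy hdF
      by_contra! hF
      obtain ⟨M, hM⟩ := hρ.eventually_mem_rayComp F
      obtain ⟨w, hw, hyw⟩ := hU.exists_adj hρ hyU
      have hp := hN (max N M) (le_max_left _ _)
      have hl : Linked G F (ρ (max N M)) w :=
        (linked_of_mem_rayComp hp hw).of_forall_notMem fun v hv hvF =>
          hF v hvF (hv.mem_rayComp hp)
      exact not_linked_of_disjoint hdF (hM _ (le_max_right _ _)) hy
        (hl.step hyw.symm (notMem_of_mem_rayComp hy))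
    obtain ⟨a, haS, ha⟩ := meets hzU' hzK hd
    obtain ⟨b, hbS', hb⟩ := meets hzU hzK' hd'
    exact hcon ((h t htS a haS htU (notMem_of_mem_rayComp ha)).trans
      ((linked_of_mem_rayComp ha hb).trans (h' b hbS' t' htS' (notMem_of_mem_rayComp hb) htU')))
  intro t ht t' ht' htU htU'
  have hm : ∀ x ∈ cornerSep G S S' ρ, x ∈ S ∨ x ∈ S' := fun x hx =>
    Finset.mem_union.1 (Finset.mem_filter.1 hx).1
  rcases hm t ht with h₁ | h₁ <;> rcases hm t' ht' with h₂ | h₂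
  · exact h t h₁ t' h₂ htU htU'
  · exact key t ht t' ht' htU htU' h₁ h₂
  · exact (key t' ht' t ht htU' htU h₂ h₁).symm
  · exact h' t h₁ t' h₂ htU htU'

/-- A minimum separator not splitting `S` does not split both corners. -/
theorem notSplit_cornerSep_or {S S' U : Finset V} (hS : IsMinSep G S)
    (hU : IsMinSep G U) {ρ ρ' : ℕ → V} (hρ : IsRay G ρ)
    (hρ' : IsRay G ρ') (hd : Disjoint (rayComp G S ρ) (rayComp G S ρ'))
    (h : NotSplit G U S) :
    NotSplit G U (cornerSep G S S' ρ) ∨ NotSplit G U (cornerSep G S S' ρ') := by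
  have aux : ∀ {σ : ℕ → V}, IsRay G σ → (∀ u ∈ U, u ∉ rayComp G S σ) →
      NotSplit G U (cornerSep G S S' σ) := fun hσ hx t ht t' ht' htU htU' =>
    hS.linked_of_disjoint hσ hx
      ((mem_of_mem_cornerSep ht).symm.imp_right fun h => ⟨h, htU⟩)
      ((mem_of_mem_cornerSep ht').symm.imp_right fun h => ⟨h, htU'⟩)
  exact ((hU.notSplit_symm h).disjoint_or hd).imp (aux hρ) (aux hρ')

theorem notSplit_self_cornerSep (S S' : Finset V) (ρ : ℕ → V) :
    NotSplit G S (cornerSep G S S' ρ) := fun _ ht _ ht' htS htS' =>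
  linked_of_mem_rayComp ((mem_of_mem_cornerSep ht).resolve_left htS)
    ((mem_of_mem_cornerSep ht').resolve_left htS')

/-- The minimum separators split by the fewest minimum separators. -/
def optimalSeps (G : SimpleGraph V) : Set (Finset V) :=
  {S | IsMinSep G S ∧ ∀ S', IsMinSep G S' → (splitters G S).ncard ≤ (splitters G S').ncard}

theorem notSplit_of_mem_optimalSeps {S S' : Finset V} (hS : S ∈ optimalSeps G)
    (hS' : S' ∈ optimalSeps G) : NotSplit G S S' := by
  by_contra hcon
  obtain ⟨hS, hSmin⟩ := hS
  obtain ⟨hS', hSmin'⟩ := hS'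
  obtain ⟨ρ, ρ', hρ, hρ', hd, hd'⟩ := exists_common_rays hS hS'
  have hT := isMinSep_cornerSep hS hS' hρ hρ' hd hd'
  have hT' := isMinSep_cornerSep hS hS' hρ' hρ hd.symm hd'.symm
  have hunion : splitters G (cornerSep G S S' ρ) ∪ splitters G (cornerSep G S S' ρ') ⊂
      splitters G S ∪ splitters G S' := by
    refine (Set.ssubset_iff_of_subset ?_).2 ⟨S, .inr ⟨hS, hcon⟩, ?_⟩
    · rintro U (⟨hU, hUT⟩ | ⟨hU, hUT⟩) <;> by_contra hx
      · exact hUT (notSplit_cornerSep hS hS' hU hcon hρ hρ' hd hd'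
          (by_contra fun h => hx (.inl ⟨hU, h⟩)) (by_contra fun h => hx (.inr ⟨hU, h⟩)))
      · exact hUT (notSplit_cornerSep hS hS' hU hcon hρ' hρ hd.symm hd'.symm
          (by_contra fun h => hx (.inl ⟨hU, h⟩)) (by_contra fun h => hx (.inr ⟨hU, h⟩)))
    · rintro (h | h)
      · exact h.2 (notSplit_self_cornerSep _ _ _)
      · exact h.2 (notSplit_self_cornerSep _ _ _)
  have hinter : splitters G (cornerSep G S S' ρ) ∩ splitters G (cornerSep G S S' ρ') ⊆
      splitters G S ∩ splitters G S' := by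
    rintro U ⟨⟨hU, h₁⟩, -, h₂⟩
    constructor <;> refine ⟨hU, fun hx => ?_⟩
    · exact (notSplit_cornerSep_or hS hU hρ hρ' hd hx).elim h₁ h₂
    · rw [cornerSep_comm] at h₁ h₂
      exact (notSplit_cornerSep_or hS' hU hρ hρ' hd' hx).elim h₁ h₂
  have fS := hS.finite_splitters
  have fS' := hS'.finite_splitters
  have c₁ := Set.ncard_lt_ncard hunion (fS.union fS')
  have c₂ := Set.ncard_le_ncard hinter (fS.inter_of_left _)
  have c₃ := Set.ncard_union_add_ncard_inter _ _ fS fS'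
  have c₄ := Set.ncard_union_add_ncard_inter _ _ hT.finite_splitters hT'.finite_splitters
  have := hSmin _ hT
  have := hSmin' _ hT'
  omega

theorem optimalSeps_nonempty (h : ∃ F, SeparatesEnds G F) : (optimalSeps G).Nonempty := by
  obtain ⟨S, hS, hmin⟩ := WellFounded.has_min (measure Finset.card).wf {F | SeparatesEnds G F} h
  have hne : {S | IsMinSep G S}.Nonempty :=
    ⟨S, hS, fun F hF => not_lt.1 (hmin F hF)⟩
  obtain ⟨T, hT, hTmin⟩ := WellFounded.has_min
    (measure fun S => (splitters G S).ncard).wf {S | IsMinSep G S} hne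
  exact ⟨T, hT, fun F hF => not_lt.1 (hTmin F hF)⟩

theorem Linked.map {F : Finset V} {x y : V} (h : Linked G F x y) (φ : G ≃g G) :
    Linked G (F.map φ.toEquiv.toEmbedding) (φ x) (φ y) := by
  obtain ⟨p, hp⟩ := h
  refine ⟨p.map φ.toHom, fun v hv hvF => ?_⟩
  rw [SimpleGraph.Walk.support_map, List.mem_map] at hv
  obtain ⟨w, hw, rfl⟩ := hv
  obtain ⟨w', hw', he⟩ := Finset.mem_map.1 hvF
  exact hp w hw (φ.injective (show φ w' = φ w from he) ▸ hw')

theorem map_map_symm (φ : G ≃g G) (F : Finset V) :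
    (F.map φ.toEquiv.toEmbedding).map φ.symm.toEquiv.toEmbedding = F := by
  ext v
  rw [Finset.mem_map_equiv, Finset.mem_map_equiv]
  exact iff_of_eq (congrArg (· ∈ F) (φ.symm_apply_apply v))

theorem map_symm_map (φ : G ≃g G) (F : Finset V) :
    (F.map φ.symm.toEquiv.toEmbedding).map φ.toEquiv.toEmbedding = F := by
  ext v
  rw [Finset.mem_map_equiv, Finset.mem_map_equiv]
  exact iff_of_eq (congrArg (· ∈ F) (φ.apply_symm_apply v))

theorem linked_map_iff (φ : G ≃g G) {F : Finset V} {x y : V} :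
    Linked G (F.map φ.toEquiv.toEmbedding) (φ x) (φ y) ↔ Linked G F x y := by
  refine ⟨fun h => ?_, fun h => h.map φ⟩
  have := h.map φ.symm
  rw [map_map_symm] at this
  simpa using this

theorem mem_rayComp_map_iff (φ : G ≃g G) {F : Finset V} {ρ : ℕ → V} {x : V} :
    φ x ∈ rayComp G (F.map φ.toEquiv.toEmbedding) (φ ∘ ρ) ↔ x ∈ rayComp G F ρ := by
  simp only [rayComp, Set.mem_ofPred_eq, Function.comp_apply, linked_map_iff]

theorem IsRay.map {ρ : ℕ → V} (h : IsRay G ρ) (φ : G ≃g G) : IsRay G (φ ∘ ρ) :=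
  ⟨φ.injective.comp h.1, fun n => φ.map_adj_iff.2 (h.2 n)⟩

theorem disjoint_rayComp_map (φ : G ≃g G) {F : Finset V} {ρ ρ' : ℕ → V}
    (h : Disjoint (rayComp G F ρ) (rayComp G F ρ')) :
    Disjoint (rayComp G (F.map φ.toEquiv.toEmbedding) (φ ∘ ρ))
      (rayComp G (F.map φ.toEquiv.toEmbedding) (φ ∘ ρ')) := by
  rw [Set.disjoint_left] at h ⊢
  intro x
  obtain ⟨y, rfl⟩ := φ.surjective x
  rw [mem_rayComp_map_iff, mem_rayComp_map_iff]
  exact @h y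

theorem IsMinSep.map {S : Finset V} (h : IsMinSep G S) (φ : G ≃g G) :
    IsMinSep G (S.map φ.toEquiv.toEmbedding) := by
  obtain ⟨⟨ρ, ρ', hρ, hρ', hd⟩, hmin⟩ := h
  refine ⟨⟨_, _, hρ.map φ, hρ'.map φ, disjoint_rayComp_map φ hd⟩, fun F hF => ?_⟩
  rw [Finset.card_map]
  exact hmin F hF

theorem NotSplit.map {S U : Finset V} (h : NotSplit G S U) (φ : G ≃g G) :
    NotSplit G (S.map φ.toEquiv.toEmbedding) (U.map φ.toEquiv.toEmbedding) := by
  intro a ha b hb ha' hb'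
  obtain ⟨u, hu, rfl⟩ := Finset.mem_map.1 ha
  obtain ⟨v, hv, rfl⟩ := Finset.mem_map.1 hb
  rw [Finset.mem_map'] at ha' hb'
  exact (h u hu v hv ha' hb').map φ

theorem map_mem_optimalSeps {S : Finset V} (h : S ∈ optimalSeps G) (φ : G ≃g G) :
    S.map φ.toEquiv.toEmbedding ∈ optimalSeps G := by
  refine ⟨h.1.map φ, fun S' hS' => le_trans ?_ (h.2 S' hS')⟩
  refine le_trans (Set.ncard_le_ncard (t := Finset.map φ.toEquiv.toEmbedding '' splitters G S)
    ?_ (h.1.finite_splitters.image _)) (Set.ncard_image_le h.1.finite_splitters)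
  rintro U ⟨hU, hUS⟩
  refine ⟨U.map φ.symm.toEquiv.toEmbedding, ⟨hU.map φ.symm, fun hx => hUS ?_⟩, map_symm_map φ U⟩
  have := hx.map φ
  rwa [map_symm_map] at this

end Separators

section Crossing

variable {V : Type u} {G : SimpleGraph V}

/-- Some optimal separator contains `s` and has `x` and `y` in two different components, both
of which contain rays. -/
def Crossed (G : SimpleGraph V) (x s y : V) : Prop :=
  ∃ U ∈ optimalSeps G, s ∈ U ∧ ∃ ρ ρ' : ℕ → V, IsRay G ρ ∧ IsRay G ρ' ∧
    Disjoint (rayComp G U ρ) (rayComp G U ρ') ∧ x ∈ rayComp G U ρ ∧ y ∈ rayComp G U ρ'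

theorem Crossed.symm {x s y : V} (h : Crossed G x s y) : Crossed G y s x := by
  obtain ⟨U, hU, hs, ρ, ρ', hρ, hρ', hd, hx, hy⟩ := h
  exact ⟨U, hU, hs, ρ', ρ, hρ', hρ, hd.symm, hy, hx⟩

theorem Crossed.map {x s y : V} (h : Crossed G x s y) (φ : G ≃g G) :
    Crossed G (φ x) (φ s) (φ y) := by
  obtain ⟨U, hU, hs, ρ, ρ', hρ, hρ', hd, hx, hy⟩ := h
  exact ⟨_, map_mem_optimalSeps hU φ, Finset.mem_map_of_mem _ hs, _, _, hρ.map φ, hρ'.map φ,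
    disjoint_rayComp_map φ hd, (mem_rayComp_map_iff φ).2 hx, (mem_rayComp_map_iff φ).2 hy⟩

/-- A sequence all of whose consecutive triples are crossed remains in the component into which
it crosses first. -/
theorem mem_rayComp_of_crossed {n : ℕ} (hn : 2 ≤ n) {w : ℕ → V}
    (hw : ∀ i, i + 2 ≤ n → Crossed G (w i) (w (i + 1)) (w (i + 2))) {U : Finset V}
    (hU : U ∈ optimalSeps G) (h1 : w 1 ∈ U) {ρ ρ' : ℕ → V}
    (hd : Disjoint (rayComp G U ρ) (rayComp G U ρ')) (h0 : w 0 ∈ rayComp G U ρ)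
    (h2 : w 2 ∈ rayComp G U ρ') : w n ∈ rayComp G U ρ' := by
  induction n, hn using Nat.le_induction generalizing w U ρ ρ' with
  | base => exact h2
  | succ n hn ih =>
    obtain ⟨U₁, hU₁, hs, σ, σ', hσ, hσ', hd₁, hx, hy⟩ := hw 1 (by omega)
    have hmem : w (n + 1) ∈ rayComp G U₁ σ' :=
      ih (w := fun i => w (i + 1)) (fun i hi => hw (i + 1) (by omega)) hU₁ hs hd₁ hx hy
    have hdis : ∀ u ∈ U, u ∉ rayComp G U₁ σ' := by
      rcases (notSplit_of_mem_optimalSeps hU₁ hU).disjoint_or hd₁ with h | h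
      · exact absurd hx (h _ h1)
      · exact h
    exact (hU₁.1.linked_of_disjoint hσ' hdis (.inr ⟨hs, notMem_of_mem_rayComp h2⟩)
      (.inl hmem)).mem_rayComp h2

theorem ne_and_not_adj_of_crossed {n : ℕ} (hn : 2 ≤ n) {w : ℕ → V}
    (hw : ∀ i, i + 2 ≤ n → Crossed G (w i) (w (i + 1)) (w (i + 2))) :
    w 0 ≠ w n ∧ ¬ G.Adj (w 0) (w n) := by
  obtain ⟨U, hU, hs, ρ, ρ', -, -, hd, hx, hy⟩ := hw 0 (by omega)
  have hmem := mem_rayComp_of_crossed hn hw hU hs hd hx hy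
  have hl := not_linked_of_disjoint hd hx hmem
  refine ⟨fun h => hl (h ▸ .refl (notMem_of_mem_rayComp hx)), fun h => hl ?_⟩
  exact .of_adj h (notMem_of_mem_rayComp hx) (notMem_of_mem_rayComp hmem)

end Crossing

section Homogeneous

variable {V : Type u} {E : V → V → Prop}

theorem IsDigraph.adj_iff (hD : IsDigraph E) {x y : V} : (UG E).Adj x y ↔ E x y ∨ E y x := by
  rw [UG, SimpleGraph.fromRel_adj]
  refine ⟨And.right, fun h => ⟨?_, h⟩⟩
  rintro rfl
  exact hD.1 x (h.elim id id)

/-- An isomorphism between finite tuples inducing connected subdigraphs extends to an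
automorphism. Connectedness is given by an enumeration in which each vertex but the first is
adjacent to an earlier one. -/
theorem DigraphCHom.exists_aut (hhom : DigraphCHom E) {n : ℕ} {f f' : Fin (n + 1) → V}
    (hf : Function.Injective f) (hf' : Function.Injective f')
    (hE : ∀ i j, E (f i) (f j) ↔ E (f' i) (f' j))
    (hc : ∀ i : Fin (n + 1), i ≠ 0 → ∃ j < i, (UG E).Adj (f j) (f i)) :
    ∃ φ : UG E ≃g UG E, (∀ x y, E (φ x) (φ y) ↔ E x y) ∧ ∀ i, φ (f i) = f' i := by
  have hconn : ((UG E).induce (Set.range f)).Connected := by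
    rw [SimpleGraph.connected_iff_exists_forall_reachable]
    refine ⟨⟨f 0, 0, rfl⟩, ?_⟩
    rintro ⟨_, i, rfl⟩
    induction i using WellFoundedLT.induction with
    | ind i ih =>
      by_cases hi : i = 0
      · subst hi
        exact .refl _
      · obtain ⟨j, hj, hadj⟩ := hc i hi
        exact (ih j hj).trans (SimpleGraph.Adj.reachable (by simpa using hadj))
  obtain ⟨ψ, hψ, hψf⟩ := hhom (Set.range f) (Set.range f') (Set.finite_range f)
    (Set.finite_range f') hconn
    ((Equiv.ofInjective f hf).symm.trans (Equiv.ofInjective f' hf')) (by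
      rintro ⟨_, i, rfl⟩ ⟨_, j, rfl⟩
      simpa [Equiv.ofInjective_symm_apply] using hE i j)
  refine ⟨⟨ψ, ?_⟩, hψ, fun i => ?_⟩
  · intro a b
    simp [UG, SimpleGraph.fromRel_adj, hψ]
  · have := hψf ⟨f i, i, rfl⟩
    simpa [Equiv.ofInjective_symm_apply] using this

theorem UG_flip (E : V → V → Prop) : UG (flip E) = UG E := by
  ext x y
  simp [UG, SimpleGraph.fromRel_adj, flip, or_comm]

theorem IsDigraph.flip (hD : IsDigraph E) : IsDigraph (flip E) :=
  ⟨hD.1, fun _ _ h => hD.2 _ _ h⟩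

theorem DigraphCHom.flip (hhom : DigraphCHom E) : DigraphCHom (flip E) := by
  intro X Y hX hY hc φ hφ
  rw [UG_flip] at hc
  obtain ⟨ψ, hψ, hψX⟩ := hhom X Y hX hY hc φ fun a b => hφ b a
  exact ⟨ψ, fun x y => hψ y x, hψX⟩

theorem not_hasTriangle_flip (htf : ¬ HasTriangle E) : ¬ HasTriangle (flip E) := by
  simpa only [HasTriangle, UG_flip] using htf

theorem DigraphCHom.exists_aut_vertex (hD : IsDigraph E) (hhom : DigraphCHom E) (x y : V) :
    ∃ φ : UG E ≃g UG E, (∀ a b, E (φ a) (φ b) ↔ E a b) ∧ φ x = y := by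
  obtain ⟨φ, hφ, h⟩ := hhom.exists_aut (n := 0) (f := ![x]) (f' := ![y])
    (fun i j _ => Subsingleton.elim (α := Fin 1) i j)
    (fun i j _ => Subsingleton.elim (α := Fin 1) i j)
    (by simp [hD.1]) (by simp)
  exact ⟨φ, hφ, h 0⟩

theorem DigraphCHom.exists_aut_edge (hD : IsDigraph E) (hhom : DigraphCHom E) {x y x' y' : V}
    (h : E x y) (h' : E x' y') : ∃ φ : UG E ≃g UG E, φ x = x' ∧ φ y = y' := by
  have hne : ∀ {a b}, E a b → a ≠ b := fun hab e => hD.1 _ (e ▸ hab)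
  obtain ⟨φ, -, hφ⟩ := hhom.exists_aut (n := 1) (f := ![x, y]) (f' := ![x', y'])
    (by simp [Function.Injective, Fin.forall_fin_two, hne h, (hne h).symm])
    (by simp [Function.Injective, Fin.forall_fin_two, hne h', (hne h').symm])
    (by simp [Fin.forall_fin_two, hD.1, h, h', hD.2 _ _ h, hD.2 _ _ h'])
    (by simp [Fin.forall_fin_two, hD.adj_iff, h])
  exact ⟨φ, hφ 0, hφ 1⟩

theorem not_rel_of_common_neighbour (hD : IsDigraph E) (htf : ¬ HasTriangle E) {s x y : V}
    (hx : E s x ∨ E x s) (hy : E s y ∨ E y s) : ¬ E x y := fun h =>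
  htf ⟨s, x, y, hD.adj_iff.2 hx, hD.adj_iff.2 (.inl h), hD.adj_iff.2 hy⟩

theorem DigraphCHom.exists_aut_path (hD : IsDigraph E) (hhom : DigraphCHom E)
    (htf : ¬ HasTriangle E) {x s y x' s' y' : V} (hx : E x s) (hy : E s y)
    (hx' : E x' s') (hy' : E s' y') :
    ∃ φ : UG E ≃g UG E, φ x = x' ∧ φ s = s' ∧ φ y = y' := by
  have hne : ∀ {a b}, E a b → a ≠ b := fun hab e => hD.1 _ (e ▸ hab)
  have hne' : ∀ {a b c}, E a b → E b c → a ≠ c := fun hab hbc e => hD.2 _ _ hab (e ▸ hbc)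
  have n1 := not_rel_of_common_neighbour hD htf (.inr hx) (.inl hy)
  have n2 := not_rel_of_common_neighbour hD htf (.inl hy) (.inr hx)
  have n1' := not_rel_of_common_neighbour hD htf (.inr hx') (.inl hy')
  have n2' := not_rel_of_common_neighbour hD htf (.inl hy') (.inr hx')
  obtain ⟨φ, -, hφ⟩ := hhom.exists_aut (n := 2) (f := ![s, x, y]) (f' := ![s', x', y'])
    (by
      simp [Function.Injective, Fin.forall_fin_succ, hne hx, (hne hx).symm, hne hy,
        (hne hy).symm, hne' hx hy, (hne' hx hy).symm])
    (by
      simp [Function.Injective, Fin.forall_fin_succ, hne hx', (hne hx').symm, hne hy',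
        (hne hy').symm, hne' hx' hy', (hne' hx' hy').symm])
    (by
      simp [Fin.forall_fin_succ, hD.1, hx, hy, hx', hy', hD.2 _ _ hx, hD.2 _ _ hy,
        hD.2 _ _ hx', hD.2 _ _ hy', n1, n2, n1', n2'])
    (fun i hi => ⟨0, Fin.pos_iff_ne_zero.2 hi, by
      revert hi
      revert i
      simp [Fin.forall_fin_succ, hD.adj_iff, hx, hy]⟩)
  exact ⟨φ, hφ 1, hφ 0, hφ 2⟩

theorem DigraphCHom.exists_aut_fork (hD : IsDigraph E) (hhom : DigraphCHom E)
    (htf : ¬ HasTriangle E) {x s y x' s' y' : V} (hx : E s x) (hy : E s y) (hxy : x ≠ y)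
    (hx' : E s' x') (hy' : E s' y') (hxy' : x' ≠ y') :
    ∃ φ : UG E ≃g UG E, φ x = x' ∧ φ s = s' ∧ φ y = y' := by
  have hne : ∀ {a b}, E a b → a ≠ b := fun hab e => hD.1 _ (e ▸ hab)
  have n1 := not_rel_of_common_neighbour hD htf (.inl hx) (.inl hy)
  have n2 := not_rel_of_common_neighbour hD htf (.inl hy) (.inl hx)
  have n1' := not_rel_of_common_neighbour hD htf (.inl hx') (.inl hy')
  have n2' := not_rel_of_common_neighbour hD htf (.inl hy') (.inl hx')
  obtain ⟨φ, -, hφ⟩ := hhom.exists_aut (n := 2) (f := ![s, x, y]) (f' := ![s', x', y'])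
    (by
      simp [Function.Injective, Fin.forall_fin_succ, hne hx, (hne hx).symm, hne hy,
        (hne hy).symm, hxy, hxy.symm])
    (by
      simp [Function.Injective, Fin.forall_fin_succ, hne hx', (hne hx').symm, hne hy',
        (hne hy').symm, hxy', hxy'.symm])
    (by
      simp [Fin.forall_fin_succ, hD.1, hx, hy, hx', hy', hD.2 _ _ hx, hD.2 _ _ hy,
        hD.2 _ _ hx', hD.2 _ _ hy', n1, n2, n1', n2'])
    (fun i hi => ⟨0, Fin.pos_iff_ne_zero.2 hi, by
      revert hi
      revert i
      simp [Fin.forall_fin_succ, hD.adj_iff, hx, hy]⟩)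
  exact ⟨φ, hφ 1, hφ 0, hφ 2⟩

theorem DigraphCHom.exists_aut_rotate (hD : IsDigraph E) (hhom : DigraphCHom E)
    (htf : ¬ HasTriangle E) {s x y z : V} (hx : E s x) (hy : E s y) (hz : E s z)
    (hxy : x ≠ y) (hyz : y ≠ z) (hxz : x ≠ z) :
    ∃ φ : UG E ≃g UG E, φ s = s ∧ φ x = y ∧ φ y = z ∧ φ z = x := by
  have hne : ∀ {a b}, E a b → a ≠ b := fun hab e => hD.1 _ (e ▸ hab)
  have hn : ∀ {a b}, E s a → E s b → ¬ E a b := fun ha hb =>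
    not_rel_of_common_neighbour hD htf (.inl ha) (.inl hb)
  obtain ⟨φ, -, hφ⟩ := hhom.exists_aut (n := 3) (f := ![s, x, y, z]) (f' := ![s, y, z, x])
    (by
      simp [Function.Injective, Fin.forall_fin_succ, hne hx, (hne hx).symm, hne hy,
        (hne hy).symm, hne hz, (hne hz).symm, hxy, hxy.symm, hyz, hyz.symm, hxz, hxz.symm])
    (by
      simp [Function.Injective, Fin.forall_fin_succ, hne hx, (hne hx).symm, hne hy,
        (hne hy).symm, hne hz, (hne hz).symm, hxy, hxy.symm, hyz, hyz.symm, hxz, hxz.symm])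
    (by
      simp [Fin.forall_fin_succ, hD.1, hx, hy, hz, hD.2 _ _ hx, hD.2 _ _ hy, hD.2 _ _ hz,
        hn hx hy, hn hy hx, hn hx hz, hn hz hx, hn hy hz, hn hz hy])
    (fun i hi => ⟨0, Fin.pos_iff_ne_zero.2 hi, by
      revert hi
      revert i
      simp [Fin.forall_fin_succ, hD.adj_iff, hx, hy, hz]⟩)
  exact ⟨φ, hφ 0, hφ 1, hφ 2, hφ 3⟩

/-- If all directed paths of length two are crossed, then every arc is induced, whence the
digraph is highly arc-transitive. -/
theorem highlyArcTransitive_of_crossed (hD : IsDigraph E) (hhom : DigraphCHom E)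
    (hcr : ∀ x s y, E x s → E s y → Crossed (UG E) x s y) : HighlyArcTransitive E := by
  have hind : ∀ {n : ℕ} {p : ℕ → V}, IsArc E n p → ∀ i j, i ≤ n → j ≤ n →
      (E (p i) (p j) ↔ j = i + 1) := by
    intro n p hp i j hi hj
    have hfar : ∀ i j, i + 2 ≤ j → j ≤ n → ¬ (UG E).Adj (p i) (p j) := by
      intro i j hij hj
      have := (ne_and_not_adj_of_crossed (G := UG E) (n := j - i) (by omega)
        (w := fun k => p (i + k)) fun k hk => hcr _ _ _ (hp.2 (i + k) (by omega))
          (hp.2 (i + k + 1) (by omega))).2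
      simpa [show i + (j - i) = j by omega] using this
    constructor
    · intro h
      have hij : i ≠ j := by
        rintro rfl
        exact hD.1 _ h
      have h₁ : ¬ i + 2 ≤ j := fun hle => hfar i j hle hj (hD.adj_iff.2 (.inl h))
      have h₂ : ¬ j + 2 ≤ i := fun hle => hfar j i hle hi (hD.adj_iff.2 (.inr h))
      have h₃ : i ≠ j + 1 := by
        rintro rfl
        exact hD.2 _ _ h (hp.2 j (by omega))
      omega
    · rintro rfl
      exact hp.2 i (by omega)
  intro n p q hp hq
  obtain ⟨φ, hφ, hpq⟩ := hhom.exists_aut (n := n) (f := fun i => p i) (f' := fun i => q i)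
    (fun i j h => Fin.ext (hp.1 i j (by omega) (by omega) h))
    (fun i j h => Fin.ext (hq.1 i j (by omega) (by omega) h))
    (fun i j => (hind hp i j (by omega) (by omega)).trans
      (hind hq i j (by omega) (by omega)).symm)
    (fun i hi => by
      have h0 : (i : ℕ) ≠ 0 := fun h => hi (Fin.ext (by simpa using h))
      refine ⟨⟨i - 1, by omega⟩, Fin.lt_def.2 (show (i : ℕ) - 1 < i by omega),
        hD.adj_iff.2 (.inl ?_)⟩
      exact (hind hp _ _ (show (i : ℕ) - 1 ≤ n by omega) (by omega)).2
        (show (i : ℕ) = i - 1 + 1 by omega))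
  exact ⟨φ.toEquiv, hφ, fun i hi => hpq ⟨i, by omega⟩⟩

/-- Suppose no directed path of length two is crossed. If an optimal separator `U` crosses an
out-fork at `s`, then all in-neighbours but no out-neighbours of `s` lie in `U`. -/
theorem neighbours_of_crossed_fork (hD : IsDigraph E) (hhom : DigraphCHom E)
    (htf : ¬ HasTriangle E) (hnc : ∀ x s y, E x s → E s y → ¬ Crossed (UG E) x s y)
    {U : Finset V} (hU : U ∈ optimalSeps (UG E)) {ρ₁ ρ₂ : ℕ → V} (h₁ : IsRay (UG E) ρ₁)
    (h₂ : IsRay (UG E) ρ₂) (hd : Disjoint (rayComp (UG E) U ρ₁) (rayComp (UG E) U ρ₂))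
    {s x₁ x₂ : V} (hs : s ∈ U) (hx₁ : x₁ ∈ rayComp (UG E) U ρ₁)
    (hx₂ : x₂ ∈ rayComp (UG E) U ρ₂) (hsx₁ : E s x₁) (hsx₂ : E s x₂) :
    (∀ z, E z s → z ∈ U) ∧ ∀ z, E s z → z ∉ U := by
  constructor
  · intro z hz
    by_contra hzU
    have hsmall : ∀ ρ, IsRay (UG E) ρ → z ∉ rayComp (UG E) U ρ := by
      intro ρ hρ hzρ
      by_cases hdis : Disjoint (rayComp (UG E) U ρ) (rayComp (UG E) U ρ₁)
      · exact hnc z s x₁ hz hsx₁ ⟨U, hU, hs, ρ, ρ₁, hρ, h₁, hdis, hzρ, hx₁⟩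
      · obtain ⟨y, hy, hy₁⟩ := Set.not_disjoint_iff.1 hdis
        exact hnc z s x₂ hz hsx₂ ⟨U, hU, hs, ρ₁, ρ₂, h₁, h₂, hd,
          (linked_of_mem_rayComp hy hzρ).mem_rayComp hy₁, hx₂⟩
    obtain ⟨φ, hφs, hφx⟩ := hhom.exists_aut_edge hD hsx₁ hz
    have hU' := map_mem_optimalSeps hU φ
    have hzU' : z ∈ U.map φ.toEquiv.toEmbedding := hφs ▸ Finset.mem_map_of_mem _ hs
    have hsK : s ∈ rayComp (UG E) (U.map φ.toEquiv.toEmbedding) (φ ∘ ρ₁) :=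
      hφx ▸ (mem_rayComp_map_iff φ).2 hx₁
    have hdis : ∀ u ∈ U.map φ.toEquiv.toEmbedding, u ∉ rayComp (UG E) U ρ₁ := fun u hu huK =>
      hsmall ρ₁ h₁ ((notSplit_of_mem_optimalSeps hU hU' u hu z hzU'
        (notMem_of_mem_rayComp huK) hzU).mem_rayComp huK)
    have hdis' : ∀ u ∈ U, u ∉ rayComp (UG E) (U.map φ.toEquiv.toEmbedding) (φ ∘ ρ₂) := by
      intro u hu huK
      have hl := hU.1.linked_of_disjoint h₁ hdis (.inr ⟨hs, notMem_of_mem_rayComp hsK⟩)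
        (.inr ⟨hu, notMem_of_mem_rayComp huK⟩)
      exact not_linked_of_disjoint (disjoint_rayComp_map φ hd) hsK huK hl
    obtain ⟨N, hN⟩ := (h₂.map φ).eventually_mem_rayComp (U.map φ.toEquiv.toEmbedding)
    refine hsmall _ (h₂.map φ) ⟨N, fun n hn => ?_⟩
    exact hU'.1.linked_of_disjoint (h₂.map φ) hdis' (.inl (hN n hn)) (.inr ⟨hzU', hzU⟩)
  · intro z hz hzU
    have hne : ∀ {x : V} {ρ : ℕ → V}, x ∈ rayComp (UG E) U ρ → x ≠ z := fun hx e =>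
      notMem_of_mem_rayComp hx (e ▸ hzU)
    have hne' : x₁ ≠ x₂ := fun e => Set.disjoint_left.1 hd hx₁ (e ▸ hx₂)
    obtain ⟨φ, -, hφ₁, hφ₂, hφz⟩ :=
      hhom.exists_aut_rotate hD htf hsx₁ hsx₂ hz hne' (hne hx₂) (hne hx₁)
    have hx₁U : x₁ ∈ U.map φ.toEquiv.toEmbedding := hφz ▸ Finset.mem_map_of_mem _ hzU
    have hx₂K : x₂ ∈ rayComp (UG E) (U.map φ.toEquiv.toEmbedding) (φ ∘ ρ₁) :=
      hφ₁ ▸ (mem_rayComp_map_iff φ).2 hx₁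
    have hzK : z ∈ rayComp (UG E) (U.map φ.toEquiv.toEmbedding) (φ ∘ ρ₂) :=
      hφ₂ ▸ (mem_rayComp_map_iff φ).2 hx₂
    rcases (notSplit_of_mem_optimalSeps hU (map_mem_optimalSeps hU φ)).disjoint_or hd with h | h
    · exact h x₁ hx₁U hx₁
    · exact not_linked_of_disjoint (disjoint_rayComp_map φ hd) hx₂K hzK
        (hU.1.linked_of_disjoint h₂ h (.inl hx₂) (.inr ⟨hzU, notMem_of_mem_rayComp hzK⟩))

theorem Crossed.of_fork (hD : IsDigraph E) (hhom : DigraphCHom E) (htf : ¬ HasTriangle E)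
    {x s y x' s' y' : V} (h : Crossed (UG E) x s y) (hx : E s x) (hy : E s y) (hxy : x ≠ y)
    (hx' : E s' x') (hy' : E s' y') (hxy' : x' ≠ y') : Crossed (UG E) x' s' y' := by
  obtain ⟨φ, rfl, rfl, rfl⟩ := hhom.exists_aut_fork hD htf hx hy hxy hx' hy' hxy'
  exact h.map φ

theorem DigraphCHom.exists_rel_ne (hD : IsDigraph E) (hhom : DigraphCHom E) {s x y : V}
    (hx : E s x) (hy : E s y) (hxy : x ≠ y) (a b : V) : ∃ c, c ≠ a ∧ E b c := by
  obtain ⟨φ, hφ, rfl⟩ := hhom.exists_aut_vertex hD s b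
  by_cases h : φ x = a
  · exact ⟨φ y, fun e => hxy (φ.injective (h.trans e.symm)), (hφ _ _).2 hy⟩
  · exact ⟨φ x, h, (hφ _ _).2 hx⟩

theorem exists_crossed_path (hD : IsDigraph E) (hconn : (UG E).Connected)
    (hhom : DigraphCHom E) (htf : ¬ HasTriangle E) (hends : ∃ F, SeparatesEnds (UG E) F) :
    ∃ x s y, E x s ∧ E s y ∧ Crossed (UG E) x s y := by
  by_contra! hnc
  obtain ⟨U, hU⟩ := optimalSeps_nonempty hends
  obtain ⟨⟨ρ₁, ρ₂, h₁, h₂, hd⟩, -⟩ := id hU.1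
  -- every vertex of `U` is the centre of an out-fork or an in-fork crossed by `U`
  set P : V → Prop := fun s => s ∈ U ∧ ∃ x ∈ rayComp (UG E) U ρ₁, ∃ y ∈ rayComp (UG E) U ρ₂,
    E s x ∧ E s y with hP
  set M : V → Prop := fun s => s ∈ U ∧ ∃ x ∈ rayComp (UG E) U ρ₁, ∃ y ∈ rayComp (UG E) U ρ₂,
    E x s ∧ E y s with hM
  have hPM : ∀ s ∈ U, P s ∨ M s := by
    intro s hs
    obtain ⟨x, hx, hsx⟩ := hU.1.exists_adj h₁ hs
    obtain ⟨y, hy, hsy⟩ := hU.1.exists_adj h₂ hs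
    have hc : Crossed (UG E) x s y := ⟨U, hU, hs, ρ₁, ρ₂, h₁, h₂, hd, hx, hy⟩
    rcases hD.adj_iff.1 hsx with h | h <;> rcases hD.adj_iff.1 hsy with h' | h'
    · exact .inl ⟨hs, x, hx, y, hy, h, h'⟩
    · exact absurd hc.symm (hnc _ _ _ h' h)
    · exact absurd hc (hnc _ _ _ h h')
    · exact .inr ⟨hs, x, hx, y, hy, h, h'⟩
  have hPn : ∀ s, P s → (∀ z, E z s → z ∈ U) ∧ ∀ z, E s z → z ∉ U := by
    rintro s ⟨hs, x, hx, y, hy, hsx, hsy⟩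
    exact neighbours_of_crossed_fork hD hhom htf hnc hU h₁ h₂ hd hs hx hy hsx hsy
  have hnc' : ∀ x s y, flip E x s → flip E s y → ¬ Crossed (UG (flip E)) x s y := by
    intro x s y hx hy hc
    rw [UG_flip] at hc
    exact hnc y s x hy hx hc.symm
  have hMn : ∀ s, M s → (∀ z, E s z → z ∈ U) ∧ ∀ z, E z s → z ∉ U := by
    rintro s ⟨hs, x, hx, y, hy, hsx, hsy⟩
    have := neighbours_of_crossed_fork (E := flip E) hD.flip hhom.flip
      (not_hasTriangle_flip htf) hnc' (U := U) (ρ₁ := ρ₁) (ρ₂ := ρ₂) (s := s) (x₁ := x) (x₂ := y)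
    rw [UG_flip] at this
    exact this hU h₁ h₂ hd hs hx hy hsx hsy
  have hPM' : ∀ {r s}, P s → E r s → M r := fun hs hrs =>
    (hPM _ ((hPn _ hs).1 _ hrs)).resolve_left fun hr => (hPn _ hr).2 _ hrs hs.1
  have hMP' : ∀ {r s}, M s → E s r → P r := fun hs hsr =>
    (hPM _ ((hMn _ hs).1 _ hsr)).resolve_right fun hr => (hMn _ hr).2 _ hsr hs.1
  have hUne : ∃ s, s ∈ U := by
    by_contra! hcon
    obtain ⟨N, hN⟩ := h₁.eventually_mem_rayComp U
    obtain ⟨N', hN'⟩ := h₂.eventually_mem_rayComp U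
    obtain ⟨p⟩ := hconn.preconnected (ρ₁ N) (ρ₂ N')
    exact not_linked_of_disjoint hd (hN N le_rfl) (hN' N' le_rfl) ⟨p, fun v _ => hcon v⟩
  obtain ⟨m, p, hm, hp, hmp⟩ : ∃ m p, M m ∧ P p ∧ E m p := by
    obtain ⟨s, hs⟩ := hUne
    rcases hPM s hs with h | h
    · obtain ⟨-, x, -, -, -, hsx, -⟩ := id h
      obtain ⟨φ, hφ, hφs⟩ := hhom.exists_aut_vertex hD x s
      have hr : E (φ s) s := by
        have := (hφ s x).2 hsx
        rwa [hφs] at this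
      exact ⟨_, s, hPM' h hr, h, hr⟩
    · obtain ⟨-, x, -, -, -, hxs, -⟩ := id h
      obtain ⟨φ, hφ, hφs⟩ := hhom.exists_aut_vertex hD x s
      have hr : E s (φ s) := by
        have := (hφ x s).2 hxs
        rwa [hφs] at this
      exact ⟨s, _, h, hMP' h hr, hr⟩
  have hneK : ∀ {x y}, x ∈ rayComp (UG E) U ρ₁ → y ∈ rayComp (UG E) U ρ₂ → x ≠ y :=
    fun hx hy e => Set.disjoint_left.1 hd hx (e ▸ hy)
  -- alternating walks in `U` can be prolonged without turning back
  have hstep : ∀ q : V × V, (P q.2 ∧ E q.1 q.2 ∨ M q.2 ∧ E q.2 q.1) →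
      ∃ c, (P c ∧ E q.2 c ∨ M c ∧ E c q.2) ∧ Crossed (UG E) q.1 q.2 c := by
    rintro ⟨a, b⟩ (⟨hb, hab⟩ | ⟨hb, hab⟩) <;> dsimp only at hb hab ⊢
    · obtain ⟨hmU, x, hx, y, hy, hxm, hym⟩ := hm
      obtain ⟨c, hca, hcb⟩ := DigraphCHom.exists_rel_ne (E := flip E) hD.flip hhom.flip
        hxm hym (hneK hx hy) a b
      refine ⟨c, .inr ⟨hPM' hb hcb, hcb⟩, ?_⟩
      have := Crossed.of_fork (E := flip E) hD.flip hhom.flip (not_hasTriangle_flip htf)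
        (x := x) (s := m) (y := y) (x' := a) (s' := b) (y' := c)
      rw [UG_flip] at this
      exact this ⟨U, hU, hmU, ρ₁, ρ₂, h₁, h₂, hd, hx, hy⟩ hxm hym (hneK hx hy) hab hcb hca.symm
    · obtain ⟨hpU, x, hx, y, hy, hpx, hpy⟩ := hp
      obtain ⟨c, hca, hbc⟩ := hhom.exists_rel_ne hD hpx hpy (hneK hx hy) a b
      exact ⟨c, .inl ⟨hMP' hb hbc, hbc⟩, Crossed.of_fork hD hhom htf
        ⟨U, hU, hpU, ρ₁, ρ₂, h₁, h₂, hd, hx, hy⟩ hpx hpy (hneK hx hy) hab hbc hca.symm⟩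
  have : Nonempty V := ⟨m⟩
  choose! next hnext hcross using hstep
  set t : ℕ → V × V := fun n => (fun q : V × V => (q.2, next q))^[n] (m, p) with ht
  have ht1 : ∀ n, t (n + 1) = ((t n).2, next (t n)) := fun n => by
    simp only [ht, Function.iterate_succ_apply']
  have hgood : ∀ n, P (t n).2 ∧ E (t n).1 (t n).2 ∨ M (t n).2 ∧ E (t n).2 (t n).1 := by
    intro n
    induction n with
    | zero => exact .inl ⟨hp, hmp⟩
    | succ n ih =>
      rw [ht1]
      exact hnext _ ih
  have hmemU : ∀ n, (t n).2 ∈ U := fun n => (hgood n).elim (fun h => h.1.1) fun h => h.1.1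
  have hcr : ∀ n, Crossed (UG E) (t n).2 (t (n + 1)).2 (t (n + 2)).2 := by
    intro n
    have := hcross _ (hgood (n + 1))
    rw [ht1 (n + 1)]
    have he : (t (n + 1)).1 = (t n).2 := by rw [ht1]
    rwa [he] at this
  have hlt : ∀ i j, i < j → (t (2 * i)).2 ≠ (t (2 * j)).2 := by
    intro i j hij
    have := (ne_and_not_adj_of_crossed (n := 2 * (j - i)) (by omega)
      (w := fun k => (t (2 * i + k)).2) fun k _ => hcr (2 * i + k)).1
    simpa [show 2 * i + 2 * (j - i) = 2 * j by omega] using this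
  have hinj : Function.Injective fun i => (⟨(t (2 * i)).2, hmemU _⟩ : U) := by
    intro i j h
    have h := Subtype.ext_iff.1 h
    rcases lt_trichotomy i j with hij | hij | hij
    · exact absurd h (hlt i j hij)
    · exact hij
    · exact absurd h.symm (hlt j i hij)
  exact not_injective_infinite_finite _ hinj

end Homogeneous

theorem MoreThanOneEnd.exists_separatesEnds {V : Type u} {G : SimpleGraph V}
    (h : MoreThanOneEnd G) : ∃ F, SeparatesEnds G F := by
  obtain ⟨r, r', hr, hr', hne⟩ := h
  rw [RayEquiv] at hne
  push Not at hne
  obtain ⟨S, hS⟩ := hne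
  refine ⟨S, r, r', hr, hr', ?_⟩
  by_contra hcon
  obtain ⟨x, hx, hx'⟩ := Set.not_disjoint_iff.1 hcon
  obtain ⟨N', hN'⟩ := hr'.eventually_mem_rayComp S
  refine hS (rayComp G S r) ⟨⟨x, hx⟩, fun y hy => notMem_of_mem_rayComp hy, ?_, ?_⟩
    (hr.eventually_mem_rayComp S)
    ⟨N', fun n hn => (linked_of_mem_rayComp hx' (hN' n hn)).mem_rayComp hx⟩
  · rw [SimpleGraph.connected_iff_exists_forall_reachable]
    refine ⟨⟨x, hx⟩, ?_⟩
    rintro ⟨y, hy⟩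
    have := (linked_of_mem_rayComp hx hy).mem_of_closed
      (K := {z | ∃ hz : z ∈ rayComp G S r, (G.induce (rayComp G S r)).Reachable ⟨x, hx⟩ ⟨z, hz⟩})
      ⟨hx, .refl _⟩ (by
        rintro a ⟨ha, hxa⟩ b hab hb
        have hbK := (Linked.of_adj hab (notMem_of_mem_rayComp ha) hb).mem_rayComp ha
        exact ⟨hbK, hxa.trans (SimpleGraph.Adj.reachable (by simpa using hab))⟩)
    exact this.2
  · intro C hC hCS hCc
    refine Set.Subset.antisymm (fun y hy => ?_) hC
    obtain ⟨p⟩ := hCc.preconnected ⟨x, hC hx⟩ ⟨y, hy⟩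
    refine Linked.mem_rayComp ⟨p.map (SimpleGraph.Embedding.induce C).toHom, fun v hv => ?_⟩ hx
    obtain ⟨w, -, rfl⟩ := List.mem_map.1 ((SimpleGraph.Walk.support_map _ p) ▸ hv)
    exact hCS w.2

/-- Every connected C-homogeneous triangle-free digraph with more than one end is
highly-arc-transitive. -/
theorem stmt_8 {V : Type u} (E : V → V → Prop) (hD : IsDigraph E)
    (hconn : (UG E).Connected) (hhom : DigraphCHom E) (htf : ¬ HasTriangle E)
    (hends : MoreThanOneEnd (UG E)) :
    HighlyArcTransitive E := by
  obtain ⟨x, s, y, hx, hy, hc⟩ :=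
    exists_crossed_path hD hconn hhom htf hends.exists_separatesEnds
  refine highlyArcTransitive_of_crossed hD hhom fun x' s' y' hx' hy' => ?_
  obtain ⟨φ, rfl, rfl, rfl⟩ := hhom.exists_aut_path hD htf hx hy hx' hy'
  exact hc.map φ
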